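/- The k-algebra kR(G) is semisimple (equivalently, Rad kR(G) = 0) if and only if p does not divide |G|. -/

import Mathlib

open scoped TensorProduct Classical

/-! Common definitions: the character ring of a finite group, following Bonnafé,
"On the character ring of a finite group". -/

/-- The set of characters of finite-dimensional `K`-linear representations of `G`. -/
def charSet (K G : Type u) [Field K] [Group G] : Set (G → K) :=
  {f | ∃ V : FDRep K G, f = FDRep.character V}

/-- The character ring `R(G)` of virtual characters, i.e. the subring of the `K`-algebra of
functions `G → K` generated by the characters.  Over a splitting field of characteristic zero
this is exactly the set of `ℤ`-linear combinations of irreducible characters. -/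
def charRing (K G : Type u) [Field K] [Group G] : Subring (G → K) :=
  Subring.closure (charSet K G)

/-- `g` is `p`-regular if its order is prime to `p`. -/
def IsPRegular (p : ℕ) {G : Type*} [Monoid G] (g : G) : Prop :=
  Nat.Coprime (orderOf g) p

/-- `g` is a `p`-element if its order is a power of `p`. -/
def IsPElement (p : ℕ) {G : Type*} [Monoid G] (g : G) : Prop :=
  ∃ n : ℕ, orderOf g = p ^ n

/-- The `p'`-part `g_{p'}` of an element `g` of a finite group:  writing `orderOf g = q * m'`
with `q` the `p`-part of the order, this is `g ^ (q * u)` where `u` is the inverse of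
`q` modulo `m'`; it is the unique `p`-regular power of `g` such that `g * g_{p'}⁻¹` is a
`p`-element commuting with it. -/
noncomputable def pPrimePart (p : ℕ) {G : Type*} [Group G] (g : G) : G :=
  g ^ (p ^ (orderOf g).factorization p *
      (((p : ZMod (orderOf g / p ^ (orderOf g).factorization p)) ^
        (orderOf g).factorization p)⁻¹).val)

/-- The `p'`-section `S_{p'}(C)` of the conjugacy class `C` of `g` : the set of all
`x ∈ G` whose `p'`-part lies in the class of `g`. -/
def pSection (p : ℕ) {G : Type*} [Group G] (g : G) : Set G :=
  {x | IsConj g (pPrimePart p x)}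

/-- The idempotent class function `e_C` attached to the class `C` of `g`:  the characteristic
function (with values in `K`) of the `p'`-section of `C`. -/
noncomputable def eFun (p : ℕ) (K : Type*) [Field K] {G : Type*} [Group G] (g : G) : G → K :=
  fun x => if IsConj g (pPrimePart p x) then 1 else 0

/-- The number of conjugacy classes of `G` contained in a subset `S`. -/
noncomputable def numClassesIn {G : Type*} [Group G] (S : Set G) : ℕ :=
  Nat.card {c : ConjClasses G // c.carrier ⊆ S}

/-- The image of the localization `𝒪_𝔭` in the fraction field `K`: fractions `a / b` with
`b ∉ 𝔭`. -/
def locSet (𝒪 K : Type*) [CommRing 𝒪] [Field K] [Algebra 𝒪 K] (𝔭 : Ideal 𝒪) : Set K :=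
  {x | ∃ a b : 𝒪, b ∉ 𝔭 ∧ x * algebraMap 𝒪 K b = algebraMap 𝒪 K a}

/-- `𝒪_𝔭 R(G)`: the `𝒪_𝔭`-span of the character ring inside class functions `G → K`,
realized as the subring generated by `𝒪_𝔭`-constants and characters. -/
def locCharRing (𝒪 : Type*) (K : Type u) [CommRing 𝒪] [Field K] [Algebra 𝒪 K] (𝔭 : Ideal 𝒪)
    (G : Type u) [Group G] : Subring (G → K) :=
  Subring.closure ({f | ∃ x ∈ locSet 𝒪 K 𝔭, f = Function.const G x} ∪ charSet K G)

/-- The ideal `𝔭 · 𝒪_𝔭R(G)` of `𝒪_𝔭R(G)`, generated by the constants from `𝔭`. -/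
def pConstIdeal (𝒪 : Type*) (K : Type u) [CommRing 𝒪] [Field K] [Algebra 𝒪 K] (𝔭 : Ideal 𝒪)
    (G : Type u) [Group G] : Ideal (locCharRing 𝒪 K 𝔭 G) :=
  Ideal.span {f | ∃ a ∈ 𝔭, (f : G → K) = Function.const G (algebraMap 𝒪 K a)}

/-- `kR(G) = k ⊗_ℤ R(G)`, realized through the canonical identification
`k ⊗_ℤ R(G) ≅ 𝒪_𝔭R(G) ⧸ 𝔭·𝒪_𝔭R(G)` (where `k = 𝒪/𝔭`). -/
abbrev kCharRing (𝒪 : Type*) (K : Type u) [CommRing 𝒪] [Field K] [Algebra 𝒪 K] (𝔭 : Ideal 𝒪)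
    (G : Type u) [Group G] :=
  locCharRing 𝒪 K 𝔭 G ⧸ pConstIdeal 𝒪 K 𝔭 G

/-- The ideal of `𝒪_𝔭R(G)` cutting out the block `R_𝔭(G, C)` with identity element the
idempotent `e : 𝒪_𝔭R(G)`, reduced mod `𝔭`:  the block `kR(G)·ē` is canonically the quotient
by `𝔭·𝒪_𝔭R(G) + (1 - e)·𝒪_𝔭R(G)`. -/
def blockIdeal (𝒪 : Type*) (K : Type u) [CommRing 𝒪] [Field K] [Algebra 𝒪 K] (𝔭 : Ideal 𝒪)
    (G : Type u) [Group G] (e : locCharRing 𝒪 K 𝔭 G) : Ideal (locCharRing 𝒪 K 𝔭 G) :=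
  pConstIdeal 𝒪 K 𝔭 G ⊔ Ideal.span {1 - e}

/-- The block `kR_𝔭(G, C) = kR(G)·ē_C` of `kR(G)`, as a (unital) `k`-algebra, realized as the
quotient of `𝒪_𝔭R(G)` by `𝔭·𝒪_𝔭R(G) + (1 - e_C)·𝒪_𝔭R(G)`. -/
abbrev blockAlg (𝒪 : Type*) (K : Type u) [CommRing 𝒪] [Field K] [Algebra 𝒪 K] (𝔭 : Ideal 𝒪)
    (G : Type u) [Group G] (e : locCharRing 𝒪 K 𝔭 G) :=
  locCharRing 𝒪 K 𝔭 G ⧸ blockIdeal 𝒪 K 𝔭 G e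

/-- The constants, as a ring morphism `𝒪 →+* 𝒪_𝔭R(G)`. -/
noncomputable def constRingHom (𝒪 : Type*) (K : Type u) [CommRing 𝒪] [Field K] [Algebra 𝒪 K]
    (𝔭 : Ideal 𝒪) [𝔭.IsMaximal] (G : Type u) [Group G] : 𝒪 →+* locCharRing 𝒪 K 𝔭 G where
  toFun a := ⟨Function.const G (algebraMap 𝒪 K a),
    Subring.subset_closure (Or.inl ⟨algebraMap 𝒪 K a,
      ⟨a, 1, fun h => (Ideal.ne_top_iff_one 𝔭).mp (Ideal.IsMaximal.ne_top ‹_›) h, by simp⟩, rfl⟩)⟩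
  map_one' := Subtype.ext (funext fun g => by simp)
  map_mul' a b := Subtype.ext (funext fun g => by simp)
  map_zero' := Subtype.ext (funext fun g => by simp)
  map_add' a b := Subtype.ext (funext fun g => by simp)

/-- The structural morphism giving quotients of `𝒪_𝔭R(G)` by ideals containing
`𝔭·𝒪_𝔭R(G)` (such as `kR(G)` and its blocks) their `k = 𝒪/𝔭`-algebra structure. -/
noncomputable def kScalars (𝒪 : Type*) (K : Type u) [CommRing 𝒪] [Field K] [Algebra 𝒪 K]
    (𝔭 : Ideal 𝒪) [𝔭.IsMaximal] (G : Type u) [Group G]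
    (I : Ideal (locCharRing 𝒪 K 𝔭 G)) (hI : pConstIdeal 𝒪 K 𝔭 G ≤ I) :
    (𝒪 ⧸ 𝔭) →+* (locCharRing 𝒪 K 𝔭 G ⧸ I) :=
  Ideal.Quotient.lift 𝔭 ((Ideal.Quotient.mk I).comp (constRingHom 𝒪 K 𝔭 G))
    (fun a ha => by
      simp only [RingHom.comp_apply]
      exact Ideal.Quotient.eq_zero_iff_mem.mpr (hI (Ideal.subset_span ⟨a, ha, rfl⟩)))

/-- The `k`-algebra structure morphism of the block `kR_𝔭(G, C)`. -/
noncomputable def blockScalars (𝒪 : Type*) (K : Type u) [CommRing 𝒪] [Field K] [Algebra 𝒪 K]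
    (𝔭 : Ideal 𝒪) [𝔭.IsMaximal] (G : Type u) [Group G] (e : locCharRing 𝒪 K 𝔭 G) :
    (𝒪 ⧸ 𝔭) →+* blockAlg 𝒪 K 𝔭 G e :=
  kScalars 𝒪 K 𝔭 G (blockIdeal 𝒪 K 𝔭 G e) le_sup_left

/-- The Jacobson radical of a ring. -/
noncomputable def jacRad (A : Type*) [CommRing A] : Ideal A := (⊥ : Ideal A).jacobson

/-- The Loewy length of `A`: the least `n` with `(Rad A) ^ n = 0`. -/
noncomputable def loewyLength (A : Type*) [CommRing A] : ℕ :=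
  sInf {n : ℕ | jacRad A ^ n = ⊥}

/-- `Rad A / (Rad A)²`. -/
noncomputable abbrev radQuotient (A : Type*) [CommRing A] :=
  jacRad A ⧸ (Submodule.comap (jacRad A).subtype (jacRad A ^ 2 : Ideal A))

/-- `dim_k Rad(A)/Rad(A)²`, the `k`-vector space structure being induced by a ring morphism
`k →+* A`. -/
noncomputable def extDim (k : Type*) [CommRing k] {A : Type*} [CommRing A] (φ : k →+* A) : ℕ :=
  letI : Module k (radQuotient A) := Module.compHom _ φ
  Module.finrank k (radQuotient A)

/-- `dim_k A`, the `k`-vector space structure being induced by a ring morphism `k →+* A`. -/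
noncomputable def kDim (k : Type*) [CommRing k] {A : Type*} [CommRing A] (φ : k →+* A) : ℕ :=
  letI : Module k A := Module.compHom _ φ
  Module.finrank k A

/-- `dim_k I` for an ideal `I` of `A`, the `k`-vector space structure being induced by a ring
morphism `k →+* A`. -/
noncomputable def idealKDim (k : Type*) [CommRing k] {A : Type*} [CommRing A] (φ : k →+* A)
    (I : Ideal A) : ℕ :=
  letI : Module k I := Module.compHom _ φ
  Module.finrank k I

section EigenProjection

variable {K A : Type*} [Field K] [Ring A] [Algebra K A]

/-- The projection onto the `ω`-eigenspace of an element `T` with `T ^ n = 1`. -/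
noncomputable def eigenProj (n : ℕ) (ω : K) (T : A) : A :=
  (n : K)⁻¹ • ∑ i ∈ Finset.range n, ω⁻¹ ^ i • T ^ i

theorem eigenProj_mul_self_eq_smul {n : ℕ} {ω : K} {T : A} (hω : ω ^ n = 1) (hω0 : ω ≠ 0)
    (hT : T ^ n = 1) : eigenProj n ω T * T = ω • eigenProj n ω T := by
  have key : (∑ i ∈ Finset.range n, ω⁻¹ ^ i • T ^ i) * (ω⁻¹ • T) =
      ∑ i ∈ Finset.range n, ω⁻¹ ^ i • T ^ i := by
    have h1 := Finset.sum_range_succ (fun i => ω⁻¹ ^ i • T ^ i) n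
    rw [Finset.sum_range_succ'] at h1
    rw [hT, inv_pow ω n, hω, inv_one, pow_zero, pow_zero] at h1
    conv_rhs => rw [← add_right_cancel h1]
    rw [Finset.sum_mul]
    refine Finset.sum_congr rfl fun i _ => ?_
    rw [smul_mul_smul_comm, ← pow_succ, ← pow_succ]
  unfold eigenProj
  conv_rhs => rw [← key]
  rw [smul_mul_assoc, mul_smul_comm, smul_comm ω, smul_inv_smul₀ hω0]

theorem eigenProj_mul_pow {n : ℕ} {ω : K} {T : A} (hω : ω ^ n = 1) (hω0 : ω ≠ 0)
    (hT : T ^ n = 1) (i : ℕ) : eigenProj n ω T * T ^ i = ω ^ i • eigenProj n ω T := by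
  induction i with
  | zero => simp
  | succ i ih =>
    rw [pow_succ, ← mul_assoc, ih, smul_mul_assoc, eigenProj_mul_self_eq_smul hω hω0 hT, smul_smul,
      pow_succ]

theorem isIdempotentElem_eigenProj {n : ℕ} {ω : K} {T : A} (hn : (n : K) ≠ 0) (hω : ω ^ n = 1)
    (hω0 : ω ≠ 0) (hT : T ^ n = 1) : IsIdempotentElem (eigenProj n ω T) := by
  unfold IsIdempotentElem
  conv_lhs => rhs; unfold eigenProj
  rw [mul_smul_comm, Finset.mul_sum]
  have (i : ℕ) : eigenProj n ω T * (ω⁻¹ ^ i • T ^ i) = eigenProj n ω T := by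
    rw [mul_smul_comm, eigenProj_mul_pow hω hω0 hT, smul_smul, ← mul_pow, inv_mul_cancel₀ hω0,
      one_pow, one_smul]
  simp only [this, Finset.sum_const, Finset.card_range, ← Nat.cast_smul_eq_nsmul K]
  exact inv_smul_smul₀ hn _

theorem sum_eigenProj {n : ℕ} {ζ : K} (hn : (n : K) ≠ 0) (hζ : IsPrimitiveRoot ζ n) (T : A) :
    ∑ j ∈ Finset.range n, eigenProj n (ζ ^ j) T = 1 := by
  unfold eigenProj
  rw [← Finset.smul_sum, Finset.sum_comm]
  have h (i : ℕ) (hi : i ∈ Finset.range n) :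
      ∑ j ∈ Finset.range n, (ζ ^ j)⁻¹ ^ i • T ^ i = if i = 0 then (n : K) • (1 : A) else 0 := by
    rw [← Finset.sum_smul]
    split_ifs with h0
    · simp [h0]
    · have h1 : (ζ ^ i)⁻¹ ≠ 1 := by
        rw [ne_eq, inv_eq_one]
        exact hζ.pow_ne_one_of_pos_of_lt h0 (Finset.mem_range.mp hi)
      have h2 := mul_geom_sum (ζ ^ i)⁻¹ n
      rw [inv_pow, ← pow_mul, mul_comm i n, pow_mul, hζ.pow_eq_one, one_pow, inv_one, sub_self,
        mul_eq_zero, or_iff_right (sub_ne_zero.mpr h1)] at h2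
      rw [← zero_smul K (T ^ i), ← h2]
      congr 1
      refine Finset.sum_congr rfl fun j _ => ?_
      rw [inv_pow, inv_pow, ← pow_mul, ← pow_mul, mul_comm]
  have hn' : 0 < n := Nat.pos_of_ne_zero (by rintro rfl; simp at hn)
  rw [Finset.sum_congr rfl h, Finset.sum_ite_eq' _ _ (fun _ => (n : K) • (1 : A)),
    if_pos (Finset.mem_range.mpr hn'), inv_smul_smul₀ hn]

theorem sum_smul_eigenProj {n : ℕ} {ζ : K} (hn : (n : K) ≠ 0) (hζ : IsPrimitiveRoot ζ n) {T : A}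
    (hT : T ^ n = 1) : ∑ j ∈ Finset.range n, ζ ^ j • eigenProj n (ζ ^ j) T = T := by
  have hζ0 : ζ ≠ 0 := hζ.ne_zero (by rintro rfl; simp at hn)
  conv_rhs => rw [← one_mul T, ← sum_eigenProj hn hζ T, Finset.sum_mul]
  refine Finset.sum_congr rfl fun j _ => (eigenProj_mul_self_eq_smul ?_ (pow_ne_zero _ hζ0) hT).symm
  rw [← pow_mul, mul_comm, pow_mul, hζ.pow_eq_one, one_pow]

theorem commute_eigenProj (n : ℕ) (ω : K) {S T : A} (h : Commute S T) :
    Commute S (eigenProj n ω T) :=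
  (Commute.sum_right _ _ _ fun i _ => (h.pow_right i).smul_right _).smul_right _

end EigenProjection

section Characters

variable {K G : Type u} [Field K] [Group G]

theorem trace_mul_mem_charSet {V : Type u} [AddCommGroup V] [Module K V] [FiniteDimensional K V]
    (ρ : Representation K G V) {P : Module.End K V} (hP : IsIdempotentElem P)
    (hc : ∀ x, Commute (ρ x) P) :
    (fun x => LinearMap.trace K V (ρ x * P)) ∈ charSet K G := by
  let ι := (LinearMap.range P).subtype
  let π := P.rangeRestrict
  have hPr (v : LinearMap.range P) : P (ι v) = ι v := by
    obtain ⟨_, w, rfl⟩ := v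
    exact LinearMap.congr_fun hP w
  let σ : Representation K G (LinearMap.range P) :=
    { toFun := fun x => π ∘ₗ ρ x ∘ₗ ι
      map_one' := by
        ext v
        simpa [π, ι] using hPr v
      map_mul' := fun x y => by
        ext v
        have h := LinearMap.congr_fun (hc y).eq (ι v)
        simp only [Module.End.mul_apply, hPr] at h
        simp only [LinearMap.coe_comp, Function.comp_apply, Module.End.mul_apply, map_mul,
          LinearMap.codRestrict_apply, π, LinearMap.rangeRestrict, ι, Submodule.coe_subtype] at h ⊢
        rw [← h] }
  refine ⟨FDRep.of σ, funext fun x => ?_⟩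
  change _ = LinearMap.trace K _ (π ∘ₗ (ρ x ∘ₗ ι))
  rw [LinearMap.trace_comp_comm']
  rfl

theorem one_mem_charSet : (1 : G → K) ∈ charSet K G := by
  refine ⟨FDRep.of (1 : Representation K G (ULift.{u} K)), funext fun x => ?_⟩
  change _ = LinearMap.trace K (ULift.{u} K) 1
  simp

theorem mul_mem_charSet {f h : G → K} (hf : f ∈ charSet K G) (hh : h ∈ charSet K G) :
    f * h ∈ charSet K G := by
  obtain ⟨V, rfl⟩ := hf
  obtain ⟨W, rfl⟩ := hh
  exact ⟨CategoryTheory.MonoidalCategoryStruct.tensorObj V W, (FDRep.char_tensor V W).symm⟩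

theorem mem_charRing_iff {f : G → K} :
    f ∈ charRing K G ↔ f ∈ AddSubgroup.closure (charSet K G) := by
  let M : Submonoid (G → K) := ⟨⟨charSet K G, mul_mem_charSet⟩, one_mem_charSet⟩
  rw [charRing, Subring.mem_closure_iff, show Submonoid.closure (charSet K G) = M from
    Submonoid.closure_eq M]
  rfl

theorem charRing_conj {f : G → K} (hf : f ∈ charRing K G) (g h : G) : f (h * g * h⁻¹) = f g := by
  rw [mem_charRing_iff] at hf
  induction hf using AddSubgroup.closure_induction with
  | mem f hf => obtain ⟨V, rfl⟩ := hf; exact FDRep.char_conj V g h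
  | zero => rfl
  | add a b _ _ ha hb => simp [ha, hb]
  | neg a _ ha => simp [ha]

theorem exists_int_sum_eq [CharZero K] [Fintype G] {f : G → K} (hf : f ∈ charRing K G) :
    ∃ m : ℤ, ∑ x, f x = Nat.card G * m := by
  have hG : (Nat.card G : K) ≠ 0 := Nat.cast_ne_zero.mpr Nat.card_pos.ne'
  let := invertibleOfNonzero hG
  rw [mem_charRing_iff] at hf
  induction hf using AddSubgroup.closure_induction with
  | mem f hf =>
    obtain ⟨V, rfl⟩ := hf
    have h := FDRep.average_char_eq_finrank_invariants V
    refine ⟨Module.finrank K (Representation.invariants V.ρ), ?_⟩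
    rw [Int.cast_natCast, ← h, mul_inv_cancel_left₀ hG]
  | zero => exact ⟨0, by simp⟩
  | add a b _ _ ha hb =>
    obtain ⟨m, hm⟩ := ha
    obtain ⟨l, hl⟩ := hb
    exact ⟨m + l, by simp [Finset.sum_add_distrib, hm, hl, mul_add]⟩
  | neg a _ ha =>
    obtain ⟨m, hm⟩ := ha
    exact ⟨-m, by simp [hm]⟩

/-- The multiplicity of the trivial character is an additive map `R(G) → ℤ`. -/
theorem exists_average [CharZero K] [Fintype G] :
    ∃ τ : charRing K G →ₗ[ℤ] ℤ, ∀ f, ∑ x, f.1 x = Nat.card G * (τ f : K) := by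
  have hG : (Nat.card G : K) ≠ 0 := Nat.cast_ne_zero.mpr Nat.card_pos.ne'
  choose τ hτ using fun f : charRing K G => exists_int_sum_eq f.2
  refine ⟨(AddMonoidHom.mk' τ fun a b => ?_).toIntLinearMap, hτ⟩
  apply Int.cast_injective (α := K)
  apply mul_left_cancel₀ hG
  rw [← hτ, Int.cast_add, mul_add, ← hτ, ← hτ, ← Finset.sum_add_distrib]
  rfl

/-- The trace of an endomorphism of finite order is an algebraic integer. -/
theorem isIntegral_trace_of_pow_eq_one {V : Type*} [AddCommGroup V] [Module K V]
    [FiniteDimensional K V] {T : Module.End K V} {n : ℕ} (hn : 0 < n) (hT : T ^ n = 1) :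
    IsIntegral ℤ (LinearMap.trace K V T) := by
  let b := Module.finBasis K V
  let B := (LinearMap.toMatrixAlgEquiv b T).map (algebraMap K (AlgebraicClosure K))
  have hB : B ^ n = 1 := by
    rw [← Matrix.map_pow, ← map_pow, hT, map_one, Matrix.map_one _ (map_zero _) (map_one _)]
  rw [← isIntegral_algebraMap_iff (algebraMap K (AlgebraicClosure K)).injective,
    LinearMap.trace_eq_matrix_trace K b, show algebraMap K (AlgebraicClosure K)
      (Matrix.trace (LinearMap.toMatrix b b T)) = B.trace from
        AddMonoidHom.map_trace (algebraMap K (AlgebraicClosure K)) _,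
    Matrix.trace_eq_sum_roots_charpoly]
  refine IsIntegral.multiset_sum fun μ hμ => ?_
  have h1 := spectrum.pow_mem_pow B n
    (Matrix.mem_spectrum_of_isRoot_charpoly (Polynomial.isRoot_of_mem_roots hμ))
  rw [hB] at h1
  have : μ ^ n = 1 := by
    by_contra h
    refine h1 (spectrum.mem_resolventSet_iff.mpr ?_)
    rw [← map_one (algebraMap (AlgebraicClosure K) (Matrix _ _ _)), ← map_sub]
    exact (IsUnit.mk0 _ (sub_ne_zero.mpr h)).map _
  exact IsIntegral.of_pow hn (this ▸ isIntegral_one)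

theorem isIntegral_charRing [Finite G] {f : G → K} (hf : f ∈ charRing K G) (g : G) :
    IsIntegral ℤ (f g) := by
  rw [mem_charRing_iff] at hf
  induction hf using AddSubgroup.closure_induction with
  | mem f hf =>
    obtain ⟨V, rfl⟩ := hf
    refine isIntegral_trace_of_pow_eq_one (n := Nat.card G) Nat.card_pos ?_
    rw [← map_pow, pow_card_eq_one', map_one]
  | zero => exact isIntegral_zero
  | add a b _ _ ha hb => exact ha.add hb
  | neg a _ ha => exact ha.neg

/-- The left translation representation of `G` on functions. -/
def leftTranslation (K G : Type u) [Field K] [Group G] : Representation K G (G → K) where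
  toFun x := LinearMap.funLeft K K fun h => x⁻¹ * h
  map_one' := by ext; simp
  map_mul' x y := LinearMap.ext fun f => funext fun h => by
    simp [LinearMap.funLeft_apply, mul_assoc]

/-- Right translation by a group element on functions. -/
def rightTranslation (K : Type u) {G : Type u} [Field K] [Group G] : G →* Module.End K (G → K) where
  toFun g := LinearMap.funLeft K K fun h => h * g
  map_one' := by ext; simp
  map_mul' x y := LinearMap.ext fun f => funext fun h => by
    simp [LinearMap.funLeft_apply, mul_assoc]

theorem commute_leftTranslation_rightTranslation (x g : G) :
    Commute (leftTranslation K G x) (rightTranslation K g) :=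
  LinearMap.ext fun f => funext fun h => congrArg f (mul_assoc x⁻¹ h g)

theorem LinearMap.trace_funLeft {R X : Type*} [CommRing R] [Fintype X] (σ : X → X) :
    LinearMap.trace R (X → R) (LinearMap.funLeft R R σ) = ∑ h, if σ h = h then 1 else 0 := by
  rw [LinearMap.trace_eq_matrix_trace R (Pi.basisFun R X), Matrix.trace]
  refine Finset.sum_congr rfl fun h _ => ?_
  simp [LinearMap.funLeft_apply, Pi.single_apply]

theorem trace_leftTranslation_mul_rightTranslation [Fintype G] (x g : G) :
    LinearMap.trace K (G → K) (leftTranslation K G x * rightTranslation K g) =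
      ∑ h : G, if h * g * h⁻¹ = x then 1 else 0 := by
  have : leftTranslation K G x * rightTranslation K g =
      LinearMap.funLeft K K fun h => x⁻¹ * h * g := rfl
  rw [this, LinearMap.trace_funLeft]
  refine Finset.sum_congr rfl fun h _ => if_congr ?_ rfl rfl
  rw [mul_inv_eq_iff_eq_mul, mul_assoc, inv_mul_eq_iff_eq_mul]

/-- Combinations of the characters induced from the linear characters of `⟨g⟩` give
multiples of the indicator function of the class of `g`. -/
theorem exists_charRing_sum_eq [CharZero K] [Fintype G] {ζ : K}
    (hζ : IsPrimitiveRoot ζ (Nat.card G)) :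
    ∃ θ : G → Fin (Nat.card G) → charRing K G, ∀ g x,
      ∑ j : Fin (Nat.card G), ζ ^ (j : ℕ) * (θ g j).1 x =
        ∑ h : G, if h * g * h⁻¹ = x then 1 else 0 := by
  have hG : (Nat.card G : K) ≠ 0 := Nat.cast_ne_zero.mpr Nat.card_pos.ne'
  have hT (g : G) : rightTranslation K g ^ Nat.card G = 1 := by
    rw [← map_pow, pow_card_eq_one', map_one]
  refine ⟨fun g j => ⟨_, Subring.subset_closure (trace_mul_mem_charSet (leftTranslation K G)
    (P := eigenProj (Nat.card G) (ζ ^ (j : ℕ)) (rightTranslation K g))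
    (isIdempotentElem_eigenProj hG ?_ (pow_ne_zero _ (hζ.ne_zero Nat.card_pos.ne')) (hT g))
    fun x => commute_eigenProj _ _ (commute_leftTranslation_rightTranslation x g))⟩, fun g x => ?_⟩
  · rw [← pow_mul, mul_comm, pow_mul, hζ.pow_eq_one, one_pow]
  · rw [← trace_leftTranslation_mul_rightTranslation, ← sum_smul_eigenProj hG hζ (hT g),
      Finset.sum_range, Finset.mul_sum, map_sum]
    simp only [mul_smul_comm, map_smul, smul_eq_mul]

/-- The regular character lies in `R(G)`. -/
theorem regularCharacter_mem_charRing [Finite G] :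
    Pi.single 1 (Nat.card G : K) ∈ charRing K G := by
  have := Fintype.ofFinite G
  refine Subring.subset_closure ?_
  convert trace_mul_mem_charSet (leftTranslation K G) IsIdempotentElem.one
    fun x => Commute.one_right _ using 1
  funext x
  rw [← map_one (rightTranslation K), trace_leftTranslation_mul_rightTranslation]
  simp [Pi.single_apply, eq_comm, Finset.sum_ite_irrel]

end Characters

section Evaluation

variable {K G : Type u} [Field K] [Group G] {𝒪 : Type*} [CommRing 𝒪] [Algebra 𝒪 K]

/-- Virtual characters take values in any integrally closed subring with fraction field `K`. -/
theorem exists_charRing_eval [Finite G] [IsDomain 𝒪] [IsIntegrallyClosed 𝒪]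
    [IsFractionRing 𝒪 K] :
    ∃ e : charRing K G →+* (G → 𝒪), ∀ f g, algebraMap 𝒪 K (e f g) = f.1 g := by
  have hinj := IsFractionRing.injective 𝒪 K
  choose e he using fun (f : charRing K G) g =>
    IsIntegrallyClosed.isIntegral_iff.mp ((isIntegral_charRing f.2 g).tower_top (A := 𝒪))
  exact ⟨{ toFun := e
           map_one' := funext fun g => hinj (by simp [he])
           map_mul' := fun a b => funext fun g => hinj (by simp [he])
           map_zero' := funext fun g => hinj (by simp [he])
           map_add' := fun a b => funext fun g => hinj (by simp [he]) }, he⟩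

/-- The `S`-linear extension of a family of evaluation morphisms. -/
noncomputable def evalTensor {S R X : Type*} [CommRing S] [CommRing R] (e : R →+* (X → S)) :
    S ⊗[ℤ] R →ₐ[S] (X → S) :=
  Algebra.TensorProduct.lift (Algebra.ofId S (X → S)) e.toIntAlgHom fun _ _ => Commute.all _ _

theorem evalTensor_tmul {S R X : Type*} [CommRing S] [CommRing R] (e : R →+* (X → S)) (a : S)
    (f : R) (x : X) : evalTensor e (a ⊗ₜ f) x = a * e f x := by
  simp [evalTensor, Algebra.ofId_apply]

variable [CharZero K] [IsDomain 𝒪] [CharZero 𝒪] [Fintype G] {ζ : K}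

theorem injective_evalTensor_charRing [FaithfulSMul 𝒪 K]
    (hζ : IsPrimitiveRoot ζ (Nat.card G)) {e : charRing K G →+* (G → 𝒪)}
    (he : ∀ f g, algebraMap 𝒪 K (e f g) = f.1 g) :
    Function.Injective (evalTensor e) := by
  have hinj := FaithfulSMul.algebraMap_injective 𝒪 K
  have hG : (Nat.card G : K) ≠ 0 := Nat.cast_ne_zero.mpr Nat.card_pos.ne'
  obtain ⟨θ, hθ⟩ := exists_charRing_sum_eq (G := G) hζ
  obtain ⟨τ, hτ⟩ := exists_average (K := K) (G := G)
  let T : charRing K G →ₗ[ℤ] (G × Fin (Nat.card G) → ℤ) :=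
    LinearMap.pi fun i => τ ∘ₗ LinearMap.mulRight ℤ (θ i.1 i.2)
  have hT : Function.Injective T := by
    rw [injective_iff_map_eq_zero]
    refine fun f hf => Subtype.ext (funext fun g => ?_)
    have h0 (j) : ∑ x, f.1 x * (θ g j).1 x = 0 := by
      have h1 := hτ (f * θ g j)
      have h2 : τ (f * θ g j) = 0 := congrFun hf (g, j)
      rw [h2, Int.cast_zero, mul_zero] at h1
      exact h1
    have h3 : ∑ x, f.1 x * ∑ j : Fin (Nat.card G), ζ ^ (j : ℕ) * (θ g j).1 x = 0 := by
      simp only [Finset.mul_sum, mul_left_comm (f.1 _)]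
      rw [Finset.sum_comm]
      simp only [← Finset.mul_sum, h0, mul_zero, Finset.sum_const_zero]
    simp only [hθ, Finset.mul_sum, mul_ite, mul_one, mul_zero] at h3
    rw [Finset.sum_comm] at h3
    simp only [Finset.sum_ite_eq, Finset.mem_univ, if_true, charRing_conj f.2, Finset.sum_const,
      Finset.card_univ, ← Nat.card_eq_fintype_card, nsmul_eq_mul] at h3
    exact (mul_eq_zero.mp h3).resolve_left hG
  have hn : (Nat.card G : 𝒪) ≠ 0 := Nat.cast_ne_zero.mpr Nat.card_pos.ne'
  have key (y : 𝒪 ⊗[ℤ] charRing K G) (i) :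
      Nat.card G * TensorProduct.piScalarRight ℤ ℤ 𝒪 _ (T.lTensor 𝒪 y) i =
        ∑ x, evalTensor e y x * e (θ i.1 i.2) x := by
    induction y using TensorProduct.induction_on with
    | zero => simp
    | add a b ha hb => simp only [map_add, Pi.add_apply, mul_add, ha, hb, add_mul,
        Finset.sum_add_distrib]
    | tmul a f =>
      simp only [evalTensor_tmul, mul_assoc, ← Finset.mul_sum]
      have h1 : ∑ x, e f x * e (θ i.1 i.2) x = Nat.card G * (τ (f * θ i.1 i.2) : 𝒪) := by
        apply hinj
        simpa [he] using hτ (f * θ i.1 i.2)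
      rw [h1, LinearMap.lTensor_tmul, TensorProduct.piScalarRight_apply,
        TensorProduct.piScalarRightHom_tmul]
      simp only [T, LinearMap.pi_apply, LinearMap.comp_apply, LinearMap.mulRight_apply,
        zsmul_eq_mul]
      ring
  rw [injective_iff_map_eq_zero]
  intro y hy
  apply Module.Flat.lTensor_preserves_injective_linearMap (M := 𝒪) T hT
  apply (TensorProduct.piScalarRight ℤ ℤ 𝒪 _).injective
  rw [map_zero, map_zero]
  funext i
  have h := key y i
  simp only [hy, Pi.zero_apply, zero_mul, Finset.sum_const_zero] at h
  exact (mul_eq_zero.mp h).resolve_left hn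

/-- Over a residue ring in which `|G|` is invertible, a virtual character with coefficients is
determined by its reduced values. -/
theorem injective_evalTensor_charRing_of_isUnit [IsIntegrallyClosed 𝒪]
    [IsFractionRing 𝒪 K] {k : Type*} [CommRing k] (φ : 𝒪 →+* k)
    (hk : IsUnit (Nat.card G : k)) (hζ : IsPrimitiveRoot ζ (Nat.card G))
    {e : charRing K G →+* (G → 𝒪)} (he : ∀ f g, algebraMap 𝒪 K (e f g) = f.1 g) :
    Function.Injective (evalTensor ((φ.compLeft G).comp e)) := by
  have hinj := FaithfulSMul.algebraMap_injective 𝒪 K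
  obtain ⟨θ, hθ⟩ := exists_charRing_sum_eq (G := G) hζ
  obtain ⟨z, rfl⟩ : ∃ z : 𝒪, algebraMap 𝒪 K z = ζ :=
    IsIntegrallyClosed.isIntegral_iff.mp (hζ.isIntegral Nat.card_pos).tower_top
  have h𝒪 (f : charRing K G) : (Nat.card G : 𝒪) ⊗ₜ[ℤ] f =
      ∑ g, ∑ j : Fin (Nat.card G), (e f g * z ^ (j : ℕ)) ⊗ₜ θ g j := by
    apply injective_evalTensor_charRing hζ he
    funext x
    apply hinj
    simp only [map_sum, Finset.sum_apply, evalTensor_tmul, map_mul, map_pow, he, mul_assoc,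
      ← Finset.mul_sum, hθ, map_natCast]
    simp only [Finset.mul_sum, mul_ite, mul_one, mul_zero]
    rw [Finset.sum_comm]
    have (h g : G) : h * (g * h⁻¹) = x ↔ h⁻¹ * x * h = g := by
      constructor <;> rintro rfl <;> group
    simp only [this, Finset.sum_ite_eq, Finset.mem_univ, if_true]
    have (h : G) : f.1 (h⁻¹ * x * h) = f.1 x := by
      simpa using charRing_conj f.2 x h⁻¹
    simp [this]
  set e' := (φ.compLeft G).comp e
  have hk' (y : k ⊗[ℤ] charRing K G) : (Nat.card G : k) • y =
      ∑ g, ∑ j : Fin (Nat.card G), (evalTensor e' y g * φ z ^ (j : ℕ)) ⊗ₜ θ g j := by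
    induction y using TensorProduct.induction_on with
    | zero => simp
    | add a b ha hb =>
      simp only [smul_add, ha, hb, map_add, Pi.add_apply, add_mul, TensorProduct.add_tmul,
        Finset.sum_add_distrib]
    | tmul a f =>
      have h := congrArg (fun y => a • φ.toAddMonoidHom.toIntLinearMap.rTensor _ y) (h𝒪 f)
      simp only [map_sum, LinearMap.rTensor_tmul, Finset.smul_sum, TensorProduct.smul_tmul'] at h
      simpa [evalTensor_tmul, TensorProduct.smul_tmul', mul_assoc, e', mul_comm a (_ : k)] using h
  rw [injective_iff_map_eq_zero]
  intro y hy
  have h := hk' y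
  simp only [hy, Pi.zero_apply, zero_mul, TensorProduct.zero_tmul, Finset.sum_const_zero] at h
  exact hk.smul_eq_zero.mp h

end Evaluation

/-- If `|G|` vanishes in `k`, the regular character gives a nonzero nilpotent in `k ⊗ R(G)`. -/
theorem not_isReduced_tensor_charRing {K G : Type u} [Field K] [CharZero K] [Group G] [Finite G]
    {k : Type*} [CommRing k] [Nontrivial k] (hk : (Nat.card G : k) = 0) :
    ¬ IsReduced (k ⊗[ℤ] charRing K G) := by
  intro _
  have := Fintype.ofFinite G
  have hG : (Nat.card G : K) ≠ 0 := Nat.cast_ne_zero.mpr Nat.card_pos.ne'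
  let ρ : charRing K G := ⟨_, regularCharacter_mem_charRing⟩
  have hρ : ρ * ρ = (Nat.card G : ℤ) • ρ := by
    refine Subtype.ext (funext fun x => ?_)
    simp [ρ, Pi.single_apply]
  have h0 : (1 : k) ⊗ₜ[ℤ] ρ = 0 := by
    refine IsNilpotent.eq_zero ⟨2, ?_⟩
    rw [pow_two, Algebra.TensorProduct.tmul_mul_tmul, hρ, TensorProduct.tmul_smul,
      TensorProduct.smul_tmul']
    simp [-Nat.card_eq_fintype_card, hk]
  obtain ⟨τ, hτ⟩ := exists_average (K := K) (G := G)
  have h1 : τ ρ = 1 := by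
    have h := hτ ρ
    simp only [ρ, Finset.sum_pi_single', Finset.mem_univ, if_true] at h
    exact_mod_cast (mul_left_cancel₀ hG ((mul_one _).trans h)).symm
  have h := congrArg (TensorProduct.rid ℤ k) (congrArg (τ.lTensor k) h0)
  simp [h1] at h

theorem isReduced_of_isSemisimpleRing (A : Type*) [CommRing A] [IsSemisimpleRing A] :
    IsReduced A := inferInstance

variable {𝒪 : Type*} [CommRing 𝒪] [IsDomain 𝒪] [IsDedekindDomain 𝒪] [CharZero 𝒪]
variable {K : Type u} [Field K] [Algebra 𝒪 K] [IsFractionRing 𝒪 K]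
variable {𝔭 : Ideal 𝒪} [𝔭.IsMaximal]

/-- The `k`-algebra `kR(G) = k ⊗_ℤ R(G)` is semisimple (equivalently, its
Jacobson radical vanishes) if and only if `p` does not divide `|G|`. -/
theorem kCharRing_semisimple_iff
    (p : ℕ) [Fact p.Prime] (hp : (p : 𝒪) ∈ 𝔭)
    {G : Type u} [Group G] [Finite G]
    (ζ : K) (hζ : IsPrimitiveRoot ζ (Nat.card G)) :
    (IsSemisimpleRing ((𝒪 ⧸ 𝔭) ⊗[ℤ] charRing K G) ↔ ¬ p ∣ Nat.card G) ∧
    ((⊥ : Ideal ((𝒪 ⧸ 𝔭) ⊗[ℤ] charRing K G)).jacobson = ⊥ ↔ ¬ p ∣ Nat.card G) := by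
  have : CharZero K := charZero_of_injective_algebraMap (IsFractionRing.injective 𝒪 K)
  have := Fintype.ofFinite G
  set A := (𝒪 ⧸ 𝔭) ⊗[ℤ] charRing K G
  have hpk : (p : 𝒪 ⧸ 𝔭) = 0 := by
    rw [← map_natCast (Ideal.Quotient.mk 𝔭), Ideal.Quotient.eq_zero_iff_mem]
    exact hp
  have hred : ¬ p ∣ Nat.card G → IsSemisimpleRing A := by
    intro hG
    let _ : Field (𝒪 ⧸ 𝔭) := Ideal.Quotient.field 𝔭
    have : CharP (𝒪 ⧸ 𝔭) p := (CharP.charP_iff_prime_eq_zero Fact.out).mpr hpk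
    obtain ⟨e, he⟩ := exists_charRing_eval (K := K) (G := G) (𝒪 := 𝒪)
    have hinj := injective_evalTensor_charRing_of_isUnit (Ideal.Quotient.mk 𝔭)
      (isUnit_iff_ne_zero.mpr fun h => hG ((CharP.cast_eq_zero_iff _ p _).mp h)) hζ he
    have : IsReduced A := isReduced_of_injective _ hinj
    have : Module.Finite (𝒪 ⧸ 𝔭) A := Module.Finite.of_injective (evalTensor _).toLinearMap hinj
    have : IsArtinianRing A := IsArtinianRing.of_finite (𝒪 ⧸ 𝔭) A
    exact IsArtinianRing.isSemisimpleRing_of_isReduced A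
  have hnil (h : IsReduced A) : ¬ p ∣ Nat.card G := fun ⟨m, hm⟩ =>
    not_isReduced_tensor_charRing (by rw [hm, Nat.cast_mul, hpk, zero_mul]) h
  refine ⟨⟨fun _ => hnil (isReduced_of_isSemisimpleRing A), hred⟩, fun h => hnil ?_, fun h => ?_⟩
  · rw [← nilradical_eq_bot_iff, eq_bot_iff, ← h]
    exact Ideal.radical_le_jacobson
  · have := hred h
    rw [Ideal.jacobson_bot]
    exact IsSemisimpleRing.jacobson_eq_bot A
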